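/- Let r ≥ 1, let (v_j)_{j≥1} satisfy |v_j| ≤ C·j^{−(1+r)}, let 1 ≤ k ≤ n, and let γ_1, γ_2, γ_3 be real numbers. Define C_k(Γ, v, r, x) = γ_1 v_k cos kx + Σ_{m=1}^∞ [γ_3 v_{mN+k} cos((mN+k)x) + γ_2 v_{mN−k} cos((mN−k)x)] and the interpolation factor hc_k = γ_1 v_k + Σ_{m=1}^∞ [γ_3 v_{mN+k} + γ_2 v_{mN−k}]. Then at every grid node x_j = 2π(j−1)/N one has C_k(Γ, v, r, x_j) = hc_k · cos(k x_j); in particular, if hc_k ≠ 0 then C_k(Γ, v, r, x_j)/hc_k = cos(k x_j) for all j = 1,…,N. -/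

import Mathlib

open Real Finset

/-- Aliasing on the uniform grid: the frequencies `m * N + k` and `k` agree at `2 * π * j / N`. -/
theorem cos_mul_add_grid {N : ℕ} (hN : N ≠ 0) (m k j : ℕ) :
    Real.cos (((m * N + k : ℕ) : ℝ) * (2 * π * j / N)) = Real.cos (k * (2 * π * j / N)) := by
  have hN' : (N : ℝ) ≠ 0 := Nat.cast_ne_zero.mpr hN
  rw [← Real.cos_add_nat_mul_two_pi (k * (2 * π * j / N)) (m * j)]
  congr 1
  push_cast
  field_simp
  ring

/-- Aliasing on the uniform grid: the frequencies `m * N - k` and `k` agree at `2 * π * j / N`. -/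
theorem cos_mul_sub_grid {N : ℕ} (hN : N ≠ 0) {m k : ℕ} (hk : k ≤ m * N) (j : ℕ) :
    Real.cos (((m * N - k : ℕ) : ℝ) * (2 * π * j / N)) = Real.cos (k * (2 * π * j / N)) := by
  have hN' : (N : ℝ) ≠ 0 := Nat.cast_ne_zero.mpr hN
  rw [← Real.cos_nat_mul_two_pi_sub (k * (2 * π * j / N)) (m * j)]
  congr 1
  push_cast [Nat.cast_sub hk]
  field_simp

/-- At every grid node `x_j`, the cosine smoothness-carrier function
satisfies `C_k(Γ, v, r, x_j) = hc_k · cos(k x_j)`; in particular, if `hc_k ≠ 0` then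
`C_k(Γ, v, r, x_j)/hc_k = cos(k x_j)` for all nodes. -/
theorem cosine_carrier_interpolation_identity
    (n : ℕ) (hn : 1 ≤ n) (N : ℕ) (hN : N = 2 * n + 1)
    (r : ℕ) (hr : 1 ≤ r)
    (v : ℕ → ℝ) (C : ℝ) (hC : 0 < C)
    (hv : ∀ j : ℕ, 1 ≤ j → |v j| ≤ C * (j : ℝ) ^ (-(1 + (r : ℝ))))
    (k : ℕ) (hk1 : 1 ≤ k) (hkn : k ≤ n)
    (γ1 γ2 γ3 : ℝ)
    (Ck : ℝ → ℝ)
    (hCk : ∀ x : ℝ, Ck x = γ1 * v k * Real.cos (k * x)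
      + ∑' m : ℕ,
        (γ3 * v ((m + 1) * N + k) * Real.cos ((((m + 1) * N + k : ℕ) : ℝ) * x)
          + γ2 * v ((m + 1) * N - k) * Real.cos ((((m + 1) * N - k : ℕ) : ℝ) * x)))
    (hc : ℝ)
    (hhc : hc = γ1 * v k
      + ∑' m : ℕ, (γ3 * v ((m + 1) * N + k) + γ2 * v ((m + 1) * N - k)))
    (x : ℕ → ℝ) (hx : ∀ j, x j = 2 * π * j / N) :
    (∀ j ∈ Finset.range N, Ck (x j) = hc * Real.cos (k * x j)) ∧
    (hc ≠ 0 → ∀ j ∈ Finset.range N, Ck (x j) / hc = Real.cos (k * x j)) := by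
  have hN0 : N ≠ 0 := by omega
  have key : ∀ j, Ck (x j) = hc * Real.cos (k * x j) := by
    intro j
    rw [hCk, hhc, add_mul, ← tsum_mul_right, hx]
    congr 2
    funext m
    have hkm : k ≤ (m + 1) * N := by nlinarith
    rw [cos_mul_add_grid hN0, cos_mul_sub_grid hN0 hkm]
    ring
  refine ⟨fun j _ => key j, fun h j _ => ?_⟩
  rw [key, mul_div_cancel_left₀ _ h]
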